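/- Let d ≥ 2 be an integer and F a field, and let L_1, …, L_d be finite sets of (affine) lines in F^d. There is a constant C = C(d), depending only on d, such that for all functions f_j : L_j → ℝ_{≥0}, 1 ≤ j ≤ d, one has ∑_{p ∈ F^d} ( ∑_{l_1 ∈ L_1} ⋯ ∑_{l_d ∈ L_d} δ(p, l_1, …, l_d) · f_1(l_1) ⋯ f_d(l_d) )^{1/(d-1)} ≤ C · ∏_{j=1}^d ( ∑_{l_j ∈ L_j} f_j(l_j) )^{1/(d-1)}. -/

import Mathlib

/- The multijoint kernel for lines: `mjDelta p l = 1` if `p` lies on every affine line `l j` and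
the directions of the `l j` together span the whole space, and `0` otherwise. -/
open Classical in
noncomputable def mjDelta {F : Type} [Field F] {n d : ℕ}
    (p : Fin n → F) (π : Fin d → AffineSubspace F (Fin n → F)) : ℝ :=
  if (∀ j, p ∈ π j) ∧ (⨆ j, (π j).direction) = ⊤ then 1 else 0

namespace Multijoint

open MvPolynomial in
/-- Substitution of the affine coordinates `x ↦ p + ∑ i, x i • b i` into a polynomial. -/
noncomputable def affineSubst {F : Type*} [Field F] {d : ℕ} (p : Fin d → F)
    (b : Fin d → Fin d → F) : MvPolynomial (Fin d) F →ₐ[F] MvPolynomial (Fin d) F :=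
  aeval fun j => C (p j) + ∑ i, C (b i j) * X i

open MvPolynomial in
/-- Substitution of the univariate polynomial `c` for the `i`-th variable, the other variables
being kept. -/
noncomputable def axisSubst {F : Type*} [Field F] {d : ℕ} (i : Fin d) (c : Polynomial F) :
    MvPolynomial (Fin d) F →ₐ[F] MvPolynomial (Fin d) (Polynomial F) :=
  aeval fun j => if j = i then C c else X j

section Substitution

open MvPolynomial

variable {F : Type*} [Field F] {d : ℕ}

theorem affineSubst_X (p : Fin d → F) (b : Fin d → Fin d → F) (j : Fin d) :
    affineSubst p b (X j) = C (p j) + ∑ i, C (b i j) * X i := by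
  simp [affineSubst]

theorem affineSubst_injective (p : Fin d → F) (b : Module.Basis (Fin d) F (Fin d → F)) :
    Function.Injective (affineSubst p b) := by
  let g : MvPolynomial (Fin d) F →ₐ[F] MvPolynomial (Fin d) F :=
    aeval fun i => ∑ k, C (b.repr (Pi.single k 1) i) * (X k - C (p k))
  have hg : g.comp (affineSubst p b) = AlgHom.id F _ := by
    refine MvPolynomial.algHom_ext fun j => ?_
    have hb : ∀ k, ∑ i, b i j * b.repr (Pi.single k 1) i = (Pi.single k 1 : Fin d → F) j := by
      intro k
      have h := congrFun (b.sum_repr (Pi.single k 1)) j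
      simpa [Finset.sum_apply, mul_comm] using h
    have hC : ∀ a : F, g (C a) = C a := fun a => by simp [g]
    have hX : ∀ i, g (X i) = ∑ k, C (b.repr (Pi.single k 1) i) * (X k - C (p k)) :=
      fun i => by simp [g]
    simp only [AlgHom.comp_apply, affineSubst_X, map_add, map_sum, map_mul, hC, hX,
      AlgHom.id_apply, Finset.mul_sum]
    rw [Finset.sum_comm]
    simp only [← mul_assoc, ← Finset.sum_mul, ← C_mul, ← map_sum, hb]
    rw [Finset.sum_eq_single j]
    · simp
    · intro k _ hk
      simp [hk.symm]
    · simp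
  intro x y hxy
  have h := congrArg g hxy
  rwa [← AlgHom.comp_apply, ← AlgHom.comp_apply, hg] at h

theorem affineSubst_mem_pow_idealOfVars (p : Fin d → F) (b : Module.Basis (Fin d) F (Fin d → F))
    (b' : Fin d → Fin d → F) (Q : MvPolynomial (Fin d) F) {v : ℕ}
    (h : affineSubst p b Q ∈ idealOfVars (Fin d) F ^ v) :
    affineSubst p b' Q ∈ idealOfVars (Fin d) F ^ v := by
  let g : MvPolynomial (Fin d) F →ₐ[F] MvPolynomial (Fin d) F :=
    aeval fun i => ∑ k, C (b.repr (b' k) i) * X k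
  have hC : ∀ a : F, g (C a) = C a := fun a => by simp [g]
  have hX : ∀ i, g (X i) = ∑ k, C (b.repr (b' k) i) * X k := fun i => by simp [g]
  have hg : g.comp (affineSubst p b) = affineSubst p b' := by
    refine MvPolynomial.algHom_ext fun j => ?_
    have hb : ∀ k, ∑ i, b i j * b.repr (b' k) i = b' k j := by
      intro k
      have h := congrFun (b.sum_repr (b' k)) j
      simpa [Finset.sum_apply, mul_comm] using h
    simp only [AlgHom.comp_apply, affineSubst_X, map_add, map_sum, map_mul, hC, hX,
      Finset.mul_sum]
    rw [Finset.sum_comm]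
    simp only [← mul_assoc, ← Finset.sum_mul, ← C_mul, ← map_sum, hb]
  have hI : (idealOfVars (Fin d) F).map g ≤ idealOfVars (Fin d) F := by
    rw [idealOfVars, Ideal.map_span, Ideal.span_le]
    rintro _ ⟨_, ⟨i, rfl⟩, rfl⟩
    rw [hX]
    exact Ideal.sum_mem _ fun k _ => Ideal.mul_mem_left _ _ (Ideal.subset_span ⟨k, rfl⟩)
  rw [← hg]
  have h1 := Ideal.mem_map_of_mem g h
  rw [Ideal.map_pow] at h1
  exact Ideal.pow_right_mono hI v h1

theorem totalDegree_affineSubst_le (p : Fin d → F) (b : Fin d → Fin d → F)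
    (Q : MvPolynomial (Fin d) F) : (affineSubst p b Q).totalDegree ≤ Q.totalDegree := by
  have hlin : ∀ j, (C (p j) + ∑ i, C (b i j) * X i : MvPolynomial (Fin d) F).totalDegree ≤ 1 := by
    intro j
    refine (totalDegree_add _ _).trans (max_le (by simp) (totalDegree_finsetSum_le fun i _ => ?_))
    refine (totalDegree_mul _ _).trans ?_
    simp
  rw [affineSubst, aeval_def, eval₂_eq]
  refine totalDegree_finsetSum_le fun m hm => ?_
  refine (totalDegree_mul _ _).trans ?_
  rw [algebraMap_eq, totalDegree_C, zero_add]
  refine (totalDegree_finsetProd _ _).trans ?_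
  refine le_trans (Finset.sum_le_sum fun j _ => ?_) (le_totalDegree hm)
  refine (totalDegree_pow _ _).trans ?_
  exact (Nat.mul_le_mul_left _ (hlin j)).trans (by simp)

theorem coeff_axisSubst_monomial (i : Fin d) (c : Polynomial F) (n m : Fin d →₀ ℕ) (a : F) :
    coeff n (axisSubst i c (monomial m a)) =
      if m.erase i = n then Polynomial.C a * c ^ m i else 0 := by
  have h : axisSubst i c (monomial m a) = monomial (m.erase i) (Polynomial.C a * c ^ m i) := by
    rw [axisSubst, aeval_monomial, Finsupp.prod_fintype _ _ (by simp), monomial_eq,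
      Finsupp.prod_fintype _ _ (by simp), map_mul, mul_assoc]
    congr 1
    rw [← Finset.mul_prod_erase _ _ (Finset.mem_univ i),
      ← Finset.mul_prod_erase _ (fun j => X j ^ (m.erase i) j) (Finset.mem_univ i)]
    simp only [if_true, Finsupp.erase_same, pow_zero, one_mul, map_pow]
    congr 1
    refine Finset.prod_congr rfl fun j hj => ?_
    have hj := Finset.ne_of_mem_erase hj
    simp [hj, Finsupp.erase_ne hj]
  rw [h, coeff_monomial]

theorem coeff_axisSubst (i : Fin d) (c : Polynomial F) (n : Fin d →₀ ℕ)
    (R : MvPolynomial (Fin d) F) :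
    coeff n (axisSubst i c R) =
      ∑ m ∈ R.support, if m.erase i = n then Polynomial.C (coeff m R) * c ^ m i else 0 := by
  conv_lhs => rw [R.as_sum]
  simp only [map_sum, coeff_sum, coeff_axisSubst_monomial]

theorem degree_erase_add (m : Fin d →₀ ℕ) (i : Fin d) :
    (m.erase i).degree + m i = m.degree := by
  conv_rhs => rw [← Finsupp.erase_add_single i m]
  simp

theorem pow_dvd_coeff_axisSubst (i : Fin d) (c : Polynomial F) (n : Fin d →₀ ℕ)
    (R : MvPolynomial (Fin d) F) {v w : ℕ} (hR : R ∈ idealOfVars (Fin d) F ^ v)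
    (hw : n.degree + w ≤ v) : c ^ w ∣ coeff n (axisSubst i c R) := by
  rw [coeff_axisSubst]
  refine Finset.dvd_sum fun m hm => ?_
  split_ifs with h
  · have h1 : v ≤ m.degree := by
      rw [mem_pow_idealOfVars_iff] at hR
      exact hR m hm
    have h2 := degree_erase_add m i
    rw [h] at h2
    exact Dvd.dvd.mul_left (pow_dvd_pow _ (by omega)) _
  · simp

theorem natDegree_coeff_axisSubst_X_le (i : Fin d) (n : Fin d →₀ ℕ)
    (R : MvPolynomial (Fin d) F) :
    (coeff n (axisSubst i Polynomial.X R)).natDegree ≤ R.totalDegree := by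
  rw [coeff_axisSubst]
  refine Polynomial.natDegree_sum_le_of_forall_le _ _ fun m hm => ?_
  split_ifs
  · refine (Polynomial.natDegree_C_mul_X_pow_le _ _).trans ?_
    have h2 := degree_erase_add m i
    have h3 := le_totalDegree hm
    change m.degree ≤ _ at h3
    omega
  · simp

theorem coeff_coeff_axisSubst_X (i : Fin d) (m : Fin d →₀ ℕ) (R : MvPolynomial (Fin d) F) :
    (coeff (m.erase i) (axisSubst i Polynomial.X R)).coeff (m i) = coeff m R := by
  rw [coeff_axisSubst, Polynomial.finsetSum_coeff, Finset.sum_eq_single m]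
  · simp
  · intro k _ hkm
    split_ifs with h
    · rw [Polynomial.coeff_C_mul_X_pow, if_neg]
      intro h2
      apply hkm
      rw [← Finsupp.erase_add_single i k, ← Finsupp.erase_add_single i m, h, h2]
    · simp
  · intro h
    simp [notMem_support_iff.mp h]

theorem axisSubst_affineSubst (i : Fin d) (t : F) (p : Fin d → F) (b : Fin d → Fin d → F)
    (Q : MvPolynomial (Fin d) F) :
    axisSubst i Polynomial.X (affineSubst p b Q) =
      axisSubst i (Polynomial.X - Polynomial.C t) (affineSubst (p + t • b i) b Q) := by
  suffices h : (axisSubst i Polynomial.X).comp (affineSubst p b) =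
      (axisSubst i (Polynomial.X - Polynomial.C t)).comp (affineSubst (p + t • b i) b) from
    DFunLike.congr_fun h Q
  refine MvPolynomial.algHom_ext fun j => ?_
  have hC : ∀ (c : Polynomial F) (a : F), axisSubst (d := d) i c (C a) = C (Polynomial.C a) := by
    intro c a
    simp [axisSubst]
  have hX : ∀ (c : Polynomial F) k, axisSubst i c (X k) = if k = i then C c else X k :=
    fun c k => by simp [axisSubst]
  simp only [AlgHom.comp_apply, affineSubst_X, map_add, map_sum, map_mul, hC, hX]
  rw [← Finset.add_sum_erase _ _ (Finset.mem_univ i), ← Finset.add_sum_erase _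
    (fun k => C (Polynomial.C (b k j)) * if k = i then C (Polynomial.X - Polynomial.C t) else X k)
    (Finset.mem_univ i)]
  have : ∀ k ∈ Finset.univ.erase i, ∀ c : Polynomial F,
      (C (Polynomial.C (b k j)) * if k = i then C c else X k :
        MvPolynomial (Fin d) (Polynomial F)) = C (Polynomial.C (b k j)) * X k := by
    intro k hk c
    rw [if_neg (Finset.ne_of_mem_erase hk)]
  rw [Finset.sum_congr rfl fun k hk => this k hk _, Finset.sum_congr rfl fun k hk => this k hk _]
  simp only [if_true, Pi.add_apply, Pi.smul_apply, smul_eq_mul, map_add, map_sub, map_mul]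
  ring

end Substitution
open MvPolynomial in
/-- If vanishing to order `T p i` in the direction `b p i` for all `p ∈ U` and `i` over-determines
polynomials of degree at most `d * m` along each line `p + F • b p i`, with the points prioritised
by the handicap `α`, then the number of vanishing conditions is at least `m ^ d`. -/
theorem le_sum_prod_of_line_conditions {F : Type*} [Field F] {d m : ℕ}
    (U : Finset (Fin d → F)) (hU : U.Nonempty)
    (b : (Fin d → F) → Module.Basis (Fin d) F (Fin d → F))
    (α : (Fin d → F) → ℤ) (T : (Fin d → F) → Fin d → ℕ)
    (h : ∀ p ∈ U, ∀ i, ∀ k : ℕ, T p i ≤ k → ∃ (W : Finset (Fin d → F)), W ⊆ U ∧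
      (∀ q ∈ W, ∃ t : F, q = p + t • b p i) ∧ d * m < ∑ q ∈ W, (k - α p + α q).toNat) :
    m ^ d ≤ ∑ p ∈ U, ∏ i, T p i := by
  classical
  by_contra! hlt
  let e : (Fin d → Fin m) → (Fin d →₀ ℕ) := fun γ => Finsupp.equivFunOnFinite.symm fun i => γ i
  have he : Function.Injective e := by
    intro γ γ' hγ
    funext i
    exact Fin.ext (by simpa [e] using DFunLike.congr_fun hγ i)
  let P : ((Fin d → Fin m) → F) →ₗ[F] MvPolynomial (Fin d) F :=
    Fintype.linearCombination F fun γ => monomial (e γ) (1 : F)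
  have hP : ∀ c γ, coeff (e γ) (P c) = c γ := by
    intro c γ
    simp [P, Fintype.linearCombination_apply, coeff_sum, coeff_smul, coeff_monomial, he.eq_iff]
  have hPdeg : ∀ c, (P c).totalDegree ≤ d * m := by
    intro c
    rw [Fintype.linearCombination_apply]
    refine totalDegree_finsetSum_le fun γ _ => (totalDegree_smul_le _ _).trans ?_
    refine (totalDegree_monomial_le _ _).trans ?_
    change (e γ).degree ≤ _
    rw [Finsupp.degree_eq_sum]
    calc ∑ i, e γ i ≤ ∑ _i : Fin d, m := Finset.sum_le_sum fun i _ => (γ i).2.le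
      _ = d * m := by simp
  let Φ : ((Fin d → Fin m) → F) →ₗ[F] ((Σ p : U, ∀ i, Fin (T p i)) → F) :=
    LinearMap.pi fun x => (lcoeff F (Finsupp.equivFunOnFinite.symm fun i => (x.2 i : ℕ))) ∘ₗ
      (affineSubst (x.1 : Fin d → F) (b x.1)).toLinearMap ∘ₗ P
  have hker : LinearMap.ker Φ ≠ ⊥ := by
    refine LinearMap.ker_ne_bot_of_finrank_lt ?_
    rw [Module.finrank_fintype_fun_eq_card, Module.finrank_fintype_fun_eq_card]
    simpa [Fintype.card_sigma, Fintype.card_pi, Finset.sum_attach U fun p => ∏ i, T p i]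
      using hlt
  obtain ⟨c, hc, hc0⟩ := Submodule.exists_mem_ne_zero_of_ne_bot hker
  set Q := P c with hQ
  have hQ0 : Q ≠ 0 := by
    intro h0
    exact hc0 (funext fun γ => by rw [← hP c γ, ← hQ, h0]; simp)
  have hΦ : ∀ p ∈ U, ∀ γ : Fin d →₀ ℕ, (∀ i, γ i < T p i) →
      coeff γ (affineSubst p (b p) Q) = 0 := by
    intro p hp γ hγ
    have h1 := congrFun (LinearMap.mem_ker.mp hc) ⟨⟨p, hp⟩, fun i => ⟨γ i, hγ i⟩⟩
    have h2 : (Finsupp.equivFunOnFinite.symm fun i => γ i) = γ := by ext; simp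
    simpa [Φ, h2] using h1
  have hv : ∀ p, ∃ γ, coeff γ (affineSubst p (b p) Q) ≠ 0 ∧
      affineSubst p (b p) Q ∈ idealOfVars (Fin d) F ^ γ.degree := by
    intro p
    have hne : (affineSubst p (b p) Q).support.Nonempty := by
      rw [support_nonempty]
      intro h0
      exact hQ0 (affineSubst_injective p (b p) (h0.trans (map_zero _).symm))
    obtain ⟨γ, hγ, hmin⟩ := Finset.exists_min_image _ Finsupp.degree hne
    exact ⟨γ, mem_support_iff.mp hγ, (mem_pow_idealOfVars_iff _ _).mpr hmin⟩
  choose γ hγ0 hγ using hv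
  obtain ⟨p, hp, hmin⟩ := Finset.exists_min_image U (fun q => ((γ q).degree : ℤ) - α q) hU
  obtain ⟨i, hi⟩ : ∃ i, T p i ≤ γ p i := by
    by_contra! hi
    exact hγ0 p (hΦ p hp _ hi)
  obtain ⟨W, hWU, hWl, hW⟩ := h p hp i _ hi
  set G := coeff ((γ p).erase i) (axisSubst i Polynomial.X (affineSubst p (b p) Q)) with hG
  have hG0 : G ≠ 0 := by
    intro h0
    apply hγ0 p
    rw [← coeff_coeff_axisSubst_X i, ← hG, h0, Polynomial.coeff_zero]
  have hGdeg : G.natDegree ≤ d * m :=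
    (natDegree_coeff_axisSubst_X_le i _ _).trans
      ((totalDegree_affineSubst_le _ _ _).trans (hPdeg c))
  choose! t ht using hWl
  have hdvd : ∏ q ∈ W, (Polynomial.X - Polynomial.C (t q)) ^ (γ p i - α p + α q).toNat ∣ G := by
    refine Finset.prod_dvd_of_coprime ?_ ?_
    · intro q hq q' hq' hne
      refine IsCoprime.pow (Polynomial.isCoprime_X_sub_C_of_isUnit_sub ?_)
      refine (sub_ne_zero.mpr fun htt => hne ?_).isUnit
      rw [ht q hq, ht q' hq', htt]
    · intro q hq
      rw [hG, axisSubst_affineSubst i (t q), ← ht q hq]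
      by_cases hw : (γ p i : ℤ) - α p + α q ≤ 0
      · rw [Int.toNat_of_nonpos hw, pow_zero]
        exact one_dvd _
      · refine pow_dvd_coeff_axisSubst i _ _ _
          (affineSubst_mem_pow_idealOfVars q (b q) _ Q (hγ q)) ?_
        have h1 := hmin q (hWU hq)
        have h2 := degree_erase_add (γ p) i
        omega
  have hdeg := Polynomial.natDegree_le_of_dvd hdvd hG0
  rw [Polynomial.natDegree_prod_of_monic _ _ fun q _ => (Polynomial.monic_X_sub_C _).pow _] at hdeg
  simp only [Polynomial.natDegree_pow, Polynomial.natDegree_X_sub_C, mul_one] at hdeg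
  omega

theorem exists_least_water_level {V : Type*} (X : Finset V) (α : V → ℤ) (N : ℕ) :
    ∃ τ : ℤ, (X.Nonempty → N < ∑ q ∈ X, (α q + τ).toNat) ∧
      ∀ τ' : ℤ, N < ∑ q ∈ X, (α q + τ').toNat → τ ≤ τ' := by
  classical
  rcases X.eq_empty_or_nonempty with rfl | hX
  · exact ⟨0, by simp, by simp⟩
  obtain ⟨q₀, hq₀⟩ := hX
  have hbdd : ∀ τ : ℤ, N < ∑ q ∈ X, (α q + τ).toNat → -∑ q ∈ X, |α q| ≤ τ := by
    intro τ hτ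
    obtain ⟨q, hq, hpos⟩ : ∃ q ∈ X, (α q + τ).toNat ≠ 0 := by
      by_contra! h0
      rw [Finset.sum_eq_zero h0] at hτ
      omega
    have h1 := Finset.single_le_sum (f := fun q => |α q|) (fun q _ => abs_nonneg _) hq
    have h2 := le_abs_self (α q)
    omega
  have hex : ∃ τ : ℤ, N < ∑ q ∈ X, (α q + τ).toNat := by
    refine ⟨N + 1 - α q₀, ?_⟩
    have h1 := Finset.single_le_sum (f := fun q => (α q + (N + 1 - α q₀)).toNat)
      (fun q _ => Nat.zero_le _) hq₀
    omega
  obtain ⟨τ, hτ, hmin⟩ := Int.exists_least_of_bdd ⟨_, hbdd⟩ hex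
  exact ⟨τ, fun _ => hτ, hmin⟩

/-- A handicap can be chosen for which the number of conditions at each point dominates any
prescribed weight of total mass less than `m ^ d`. -/
theorem exists_balanced_weights {V Λ : Type*} {d m N : ℕ} (P : Finset V)
    (inc : V → Λ → Prop) [∀ l, DecidablePred (inc · l)] (J : V → (Fin d → Λ) → Prop)
    (hJ : ∀ p l, J p l → ∀ i, inc p (l i)) (w : V → ℝ) (hw0 : ∀ p, 0 ≤ w p)
    (key : ∀ U ⊆ P, U.Nonempty → ∀ (α : V → ℤ) (τ : Λ → ℤ) (j : V → Fin d → Λ),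
      (∀ p ∈ U, J p (j p)) →
      (∀ p ∈ U, ∀ i, N < ∑ q ∈ U with inc q (j p i), (α q + τ (j p i)).toNat) →
      m ^ d ≤ ∑ p ∈ U, ∏ i, (α p + τ (j p i)).toNat)
    (hw : ∑ p ∈ P, w p < (m : ℝ) ^ d) :
    ∃ S : V → Λ → ℕ, (∀ l, ∑ p ∈ P with inc p l, S p l ≤ N + 2 * P.card) ∧
      ∀ p ∈ P, ∀ l, J p l → w p ≤ ∏ i, (S p (l i) : ℝ) := by
  classical
  choose τ hτ hτmin using fun (α : V → ℕ) (l : Λ) =>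
    exists_least_water_level (P.filter (inc · l)) (fun q => (α q : ℤ)) N
  let S : (V → ℕ) → V → Λ → ℕ := fun α p l => (α p + τ α l).toNat
  have hS : ∀ α l, ∑ p ∈ P with inc p l, S α p l ≤ N + P.card := by
    intro α l
    have h1 : ∑ p ∈ P with inc p l, ((α p : ℤ) + (τ α l - 1)).toNat ≤ N := by
      by_contra! h
      have := hτmin α l _ h
      omega
    calc ∑ p ∈ P with inc p l, S α p l
        ≤ ∑ p ∈ P with inc p l, (((α p : ℤ) + (τ α l - 1)).toNat + 1) :=
          Finset.sum_le_sum fun p _ => by simp only [S]; omega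
      _ ≤ N + P.card := by
          rw [Finset.sum_add_distrib]
          have := Finset.card_filter_le P (inc · l)
          simp only [Finset.sum_const, smul_eq_mul, mul_one]
          omega
  let A : Set (V → ℕ) := {α | ∀ p ∈ P, 0 < α p → ∃ l, J p l ∧ ∏ i, (S α p (l i) : ℝ) ≤ w p}
  set K := N + P.card + 1 with hK
  have hbdd : ∀ α ∈ A, ∀ p ∈ P, α p < (P.card + 1) * K := by
    intro α hα p₀ hp₀
    by_contra! hbig
    obtain ⟨k, hk, hkα⟩ : ∃ k ∈ Finset.range (P.card + 1), k ∉ P.image fun p => α p / K := by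
      refine Finset.exists_mem_notMem_of_card_lt_card ?_
      rw [Finset.card_range]
      exact Nat.lt_succ_of_le Finset.card_image_le
    let U := P.filter fun p => k < α p / K
    have hKpos : 0 < K := by omega
    have hUne : U.Nonempty := by
      refine ⟨p₀, Finset.mem_filter.mpr ⟨hp₀, ?_⟩⟩
      have h1 : P.card + 1 ≤ α p₀ / K := (Nat.le_div_iff_mul_le hKpos).mpr hbig
      have h2 := Finset.mem_range.mp hk
      omega
    have hUJ : ∀ p ∈ U, ∃ l, J p l ∧ ∏ i, (S α p (l i) : ℝ) ≤ w p := by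
      intro p hp
      obtain ⟨hpP, hpk⟩ := Finset.mem_filter.mp hp
      refine hα p hpP (Nat.pos_of_ne_zero fun h0 => ?_)
      simp [h0] at hpk
    have hUne' := hUne
    obtain ⟨p₁, hp₁⟩ := hUne
    obtain ⟨l₁, _⟩ := hUJ p₁ hp₁
    have : Nonempty (Fin d → Λ) := ⟨l₁⟩
    choose! j hjJ hjw using hUJ
    have hle := key U (Finset.filter_subset _ _) hUne' (fun q => α q) (τ α) j hjJ ?_
    · have h1 : (m : ℝ) ^ d ≤ ∑ p ∈ U, ∏ i, (S α p (j p i) : ℝ) := by exact_mod_cast hle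
      have h2 : ∑ p ∈ U, ∏ i, (S α p (j p i) : ℝ) ≤ ∑ p ∈ P, w p :=
        (Finset.sum_le_sum hjw).trans
          (Finset.sum_le_sum_of_subset_of_nonneg (Finset.filter_subset _ _) fun p _ _ => hw0 p)
      linarith
    · intro p hp i
      obtain ⟨hpP, hpk⟩ := Finset.mem_filter.mp hp
      have hinc := hJ p _ (hjJ p hp) i
      have hpX : p ∈ P.filter (inc · (j p i)) := Finset.mem_filter.mpr ⟨hpP, hinc⟩
      refine lt_of_lt_of_eq (hτ α (j p i) ⟨p, hpX⟩) ?_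
      refine (Finset.sum_subset (Finset.filter_subset_filter _ (Finset.filter_subset _ _)) ?_).symm
      intro q hq hqU
      obtain ⟨hqP, hql⟩ := Finset.mem_filter.mp hq
      have hqk : ¬ k < α q / K := fun h =>
        hqU (Finset.mem_filter.mpr ⟨Finset.mem_filter.mpr ⟨hqP, h⟩, hql⟩)
      have hqk' : α q / K ≠ k := fun h => hkα (Finset.mem_image.mpr ⟨q, hqP, h⟩)
      have h1 : α q < k * K := (Nat.div_lt_iff_lt_mul hKpos).mp (by omega)
      have h2 : (k + 1) * K ≤ α p := (Nat.le_div_iff_mul_le hKpos).mp hpk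
      have h3 : S α p (j p i) ≤ N + P.card :=
        (Finset.single_le_sum (f := fun p' => S α p' (j p i)) (fun _ _ => Nat.zero_le _) hpX).trans
          (hS α _)
      rw [add_mul, one_mul] at h2
      simp only [S] at h3
      apply Int.toNat_of_nonpos
      omega
  obtain ⟨_, ⟨α, hα, rfl⟩, hmax⟩ : ∃ s : ℤ, (∃ α ∈ A, s = ∑ p ∈ P, (α p : ℤ)) ∧
      ∀ s' : ℤ, (∃ α ∈ A, s' = ∑ p ∈ P, (α p : ℤ)) → s' ≤ s := by
    refine Int.exists_greatest_of_bdd ⟨∑ _p ∈ P, ((P.card + 1) * K : ℕ), ?_⟩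
      ⟨_, fun _ => 0, fun p _ h => absurd h (lt_irrefl 0), rfl⟩
    rintro _ ⟨α, hα, rfl⟩
    exact Finset.sum_le_sum fun p hp => by exact_mod_cast (hbdd α hα p hp).le
  refine ⟨fun p l => S α p l + 1, fun l => ?_, fun p hp l hl => ?_⟩
  · rw [Finset.sum_add_distrib]
    have h1 := hS α l
    have h2 := Finset.card_filter_le P (inc · l)
    simp only [Finset.sum_const, smul_eq_mul, mul_one]
    omega
  · let β := Function.update α p (α p + 1)
    have hβp : β p = α p + 1 := by simp [β]
    have hβq : ∀ q, q ≠ p → β q = α q := fun q hq => by simp [β, hq]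
    have hαβ : ∀ q, α q ≤ β q := by
      intro q
      by_cases hq : q = p
      · subst hq; omega
      · exact (hβq q hq).ge
    have hβA : β ∉ A := by
      intro hβ
      have h1 := hmax _ ⟨β, hβ, rfl⟩
      have h2 : ∑ q ∈ P, (α q : ℤ) < ∑ q ∈ P, (β q : ℤ) :=
        Finset.sum_lt_sum (fun q _ => by exact_mod_cast hαβ q) ⟨p, hp, by rw [hβp]; simp⟩
      omega
    have hττ : ∀ q ∈ P, ∀ l', inc q l' → τ β l' ≤ τ α l' := by
      intro q hq l' hl'
      refine hτmin β l' _ ((hτ α l' ⟨q, Finset.mem_filter.mpr ⟨hq, hl'⟩⟩).trans_le ?_)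
      refine Finset.sum_le_sum fun r _ => Int.toNat_le_toNat ?_
      have := hαβ r
      omega
    simp only [A, Set.mem_ofPred_eq] at hβA
    push Not at hβA
    obtain ⟨q, hqP, hqpos, hq⟩ := hβA
    by_cases hqp : q = p
    · subst hqp
      refine (hq l hl).le.trans (Finset.prod_le_prod (fun _ _ => Nat.cast_nonneg _) fun i _ => ?_)
      have h1 := hττ q hqP (l i) (hJ _ _ hl i)
      have h2 : S β q (l i) ≤ S α q (l i) + 1 := by
        simp only [S]
        omega
      exact_mod_cast h2
    · rw [hβq q hqp] at hqpos
      obtain ⟨l', hl', hle⟩ := hα q hqP hqpos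
      refine absurd (hq l' hl') (not_lt.mpr (le_trans ?_ hle))
      refine Finset.prod_le_prod (fun _ _ => Nat.cast_nonneg _) fun i _ => ?_
      have h1 := hττ q hqP (l' i) (hJ _ _ hl' i)
      have h2 : S β q (l' i) ≤ S α q (l' i) := by
        simp only [S, hβq q hqp]
        omega
      exact_mod_cast h2

theorem exists_basis_of_lines {F : Type*} [Field F] {d : ℕ} (p : Fin d → F)
    (l : Fin d → AffineSubspace F (Fin d → F)) (hp : ∀ i, p ∈ l i)
    (h1 : ∀ i, Module.finrank F (l i).direction = 1) (htop : ⨆ i, (l i).direction = ⊤) :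
    ∃ b : Module.Basis (Fin d) F (Fin d → F),
      ∀ i, ∀ q ∈ l i, ∃ t : F, q = p + t • b i := by
  have hv : ∀ i, ∃ v : Fin d → F, ∀ x ∈ (l i).direction, ∃ c : F, c • v = x := by
    intro i
    obtain ⟨v, _, hv⟩ := finrank_eq_one_iff'.mp (h1 i)
    refine ⟨v, fun x hx => ?_⟩
    obtain ⟨c, hc⟩ := hv ⟨x, hx⟩
    exact ⟨c, by simpa using congrArg Subtype.val hc⟩
  choose v hv using hv
  have hspan : ⊤ ≤ Submodule.span F (Set.range v) := by
    rw [← htop]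
    refine iSup_le fun i x hx => ?_
    obtain ⟨c, rfl⟩ := hv i x hx
    exact Submodule.smul_mem _ _ (Submodule.subset_span ⟨i, rfl⟩)
  refine ⟨basisOfTopLeSpanOfCardEqFinrank v hspan (by simp), fun i q hq => ?_⟩
  obtain ⟨c, hc⟩ := hv i (q - p) (AffineSubspace.vsub_mem_direction hq (hp i))
  exact ⟨c, by simp [hc]⟩

/-- Hölder's inequality for `d` functions with equal exponents. -/
theorem sum_prod_rpow_le {V : Type*} {d : ℕ} (hd : 0 < d) (P : Finset V)
    (H : Fin d → V → ℝ) (hH : ∀ j p, 0 ≤ H j p) (G : Fin d → ℝ)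
    (hG : ∀ j, ∑ p ∈ P, H j p ≤ G j) :
    ∑ p ∈ P, ∏ j, H j p ^ ((d : ℝ)⁻¹) ≤ ∏ j, G j ^ ((d : ℝ)⁻¹) := by
  have hd' : (d : ℝ) ≠ 0 := by positivity
  have hG0 : ∀ j, 0 ≤ G j := fun j => (Finset.sum_nonneg fun p _ => hH j p).trans (hG j)
  by_cases hz : ∃ j, G j = 0
  · obtain ⟨j, hj⟩ := hz
    have h0 : ∀ p ∈ P, H j p = 0 := fun p hp =>
      le_antisymm (((Finset.single_le_sum (fun q _ => hH j q) hp).trans (hG j)).trans hj.le)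
        (hH j p)
    rw [Finset.sum_eq_zero fun p hp => Finset.prod_eq_zero (Finset.mem_univ j)
      (by rw [h0 p hp, Real.zero_rpow (inv_ne_zero hd')])]
    exact Finset.prod_nonneg fun j _ => Real.rpow_nonneg (hG0 j) _
  · push Not at hz
    have hpos : ∀ j, 0 < G j := fun j => lt_of_le_of_ne (hG0 j) (hz j).symm
    have hterm : ∀ p, ∏ j, H j p ^ ((d : ℝ)⁻¹) ≤
        (∏ j, G j ^ ((d : ℝ)⁻¹)) * ∑ j, (d : ℝ)⁻¹ * (H j p / G j) := by
      intro p
      have h1 := Real.geom_mean_le_arith_mean_weighted Finset.univ (fun _ : Fin d => (d : ℝ)⁻¹)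
        (fun j => H j p / G j) (fun _ _ => by positivity) (by simp [hd'])
        (fun j _ => div_nonneg (hH j p) (hG0 j))
      refine le_trans (le_of_eq ?_)
        (mul_le_mul_of_nonneg_left h1 (Finset.prod_nonneg fun j _ => Real.rpow_nonneg (hG0 j) _))
      rw [← Finset.prod_mul_distrib]
      refine Finset.prod_congr rfl fun j _ => ?_
      rw [← Real.mul_rpow (hG0 j) (div_nonneg (hH j p) (hG0 j)), mul_div_cancel₀ _ (hz j)]
    refine (Finset.sum_le_sum fun p _ => hterm p).trans ?_
    rw [← Finset.mul_sum, Finset.sum_comm]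
    refine mul_le_of_le_one_right (Finset.prod_nonneg fun j _ => Real.rpow_nonneg (hG0 j) _) ?_
    calc ∑ j, ∑ p ∈ P, (d : ℝ)⁻¹ * (H j p / G j) ≤ ∑ _j : Fin d, (d : ℝ)⁻¹ := by
          refine Finset.sum_le_sum fun j _ => ?_
          rw [← Finset.mul_sum, ← Finset.sum_div]
          exact mul_le_of_le_one_right (by positivity) ((div_le_one (hpos j)).mpr (hG j))
      _ = 1 := by simp [hd']

theorem mjDelta_eq_one_of_ne_zero {F : Type} [Field F] {n d : ℕ} {p : Fin n → F}
    {l : Fin d → AffineSubspace F (Fin n → F)} (h : mjDelta p l ≠ 0) :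
    mjDelta p l = 1 ∧ (∀ j, p ∈ l j) ∧ ⨆ j, (l j).direction = ⊤ := by
  unfold mjDelta at h ⊢
  split_ifs at h ⊢ with h'
  · exact ⟨rfl, h'⟩
  · exact absurd rfl h

theorem mjDelta_nonneg {F : Type} [Field F] {n d : ℕ} (p : Fin n → F)
    (l : Fin d → AffineSubspace F (Fin n → F)) : 0 ≤ mjDelta p l := by
  unfold mjDelta
  split_ifs <;> norm_num

/-- The dual form of the multijoint inequality: any weight on the points can be distributed along
the lines. -/
theorem exists_line_weights {F : Type} [Field F] {d : ℕ} (m : ℕ)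
    (L : Fin d → Finset (AffineSubspace F (Fin d → F)))
    (hL : ∀ j, ∀ l ∈ L j, Module.finrank F l.direction = 1)
    (P : Finset (Fin d → F)) [∀ l : AffineSubspace F (Fin d → F), DecidablePred (· ∈ l)]
    (w : (Fin d → F) → ℝ) (hw0 : ∀ p, 0 ≤ w p) (hw : ∑ p ∈ P, w p < (m : ℝ) ^ d) :
    ∃ S : (Fin d → F) → AffineSubspace F (Fin d → F) → ℕ,
      (∀ l, ∑ p ∈ P with p ∈ l, S p l ≤ d * m + 2 * P.card) ∧
      ∀ p ∈ P, ∀ l ∈ Fintype.piFinset L, mjDelta p l ≠ 0 → w p ≤ ∏ i, (S p (l i) : ℝ) := by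
  have h := exists_balanced_weights (d := d) (m := m) (N := d * m) P
    (fun p (l : AffineSubspace F (Fin d → F)) => p ∈ l)
    (fun p l => l ∈ Fintype.piFinset L ∧ mjDelta p l ≠ 0)
    (fun p l h i => (mjDelta_eq_one_of_ne_zero h.2).2.1 i) w hw0
  suffices key : _ by
    obtain ⟨S, hS1, hS2⟩ := h key hw
    exact ⟨S, hS1, fun p hp l hl h => hS2 p hp l ⟨hl, h⟩⟩
  intro U _ hU α τ j hj hN
  have hb : ∀ p, ∃ b : Module.Basis (Fin d) F (Fin d → F),
      p ∈ U → ∀ i, ∀ q ∈ j p i, ∃ t : F, q = p + t • b i := by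
    intro p
    by_cases hp : p ∈ U
    · obtain ⟨hl, hδ⟩ := hj p hp
      obtain ⟨_, hmem, htop⟩ := mjDelta_eq_one_of_ne_zero hδ
      obtain ⟨b, hb⟩ := exists_basis_of_lines p (j p) hmem
        (fun i => hL i _ (Fintype.mem_piFinset.mp hl i)) htop
      exact ⟨b, fun _ => hb⟩
    · exact ⟨Pi.basisFun F (Fin d), fun h => absurd h hp⟩
  choose b hb using hb
  refine le_sum_prod_of_line_conditions U hU b α (fun p i => (α p + τ (j p i)).toNat) ?_
  intro p hp i k hk
  refine ⟨U.filter (· ∈ j p i), Finset.filter_subset _ _, fun q hq => ?_,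
    (hN p hp i).trans_le (Finset.sum_le_sum fun q _ => Int.toNat_le_toNat ?_)⟩
  · exact hb p hp i q (Finset.mem_filter.mp hq).2
  · omega

theorem rpow_inv_sub_one_pow {d : ℕ} (hd : 2 ≤ d) {a : ℝ} (ha : 0 ≤ a) :
    (a ^ (((d : ℝ) - 1)⁻¹)) ^ d = a * a ^ (((d : ℝ) - 1)⁻¹) := by
  have hd1 : (0 : ℝ) < (d : ℝ) - 1 := by
    have : (2 : ℝ) ≤ d := by exact_mod_cast hd
    linarith
  rcases ha.eq_or_lt with rfl | ha
  · rw [Real.zero_rpow (inv_pos.mpr hd1).ne', zero_pow (by omega), mul_zero]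
  · rw [← Real.rpow_natCast, ← Real.rpow_mul ha.le, ← Real.rpow_one_add' ha.le (by positivity)]
    congr 1
    field_simp
    ring

theorem sum_multijoint_le {F : Type} [Field F] {d : ℕ} (hd : 2 ≤ d)
    (L : Fin d → Finset (AffineSubspace F (Fin d → F)))
    (hL : ∀ j, ∀ l ∈ L j, Module.finrank F l.direction = 1)
    (f : Fin d → AffineSubspace F (Fin d → F) → ℝ) (hf : ∀ j l, 0 ≤ f j l)
    (P : Finset (Fin d → F)) :
    ∑ p ∈ P, (∑ l ∈ Fintype.piFinset L, mjDelta p l * ∏ j, f j (l j)) ^ (((d : ℝ) - 1)⁻¹) ≤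
      (2 * ((d : ℝ) + 2) ^ d) ^ (((d : ℝ) - 1)⁻¹) *
        ∏ j, (∑ l ∈ L j, f j l) ^ (((d : ℝ) - 1)⁻¹) := by
  classical
  set A : (Fin d → F) → ℝ := fun p => ∑ l ∈ Fintype.piFinset L, mjDelta p l * ∏ j, f j (l j)
    with hA
  set θ : ℝ := ((d : ℝ) - 1)⁻¹ with hθ
  set E : ℝ := ∑ p ∈ P, A p ^ θ with hE
  set B : ℝ := (d : ℝ) + 2 with hB
  have hd0 : 0 < d := by omega
  have hd1 : (0 : ℝ) < (d : ℝ) - 1 := by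
    have : (2 : ℝ) ≤ d := by exact_mod_cast hd
    linarith
  have hA0 : ∀ p, 0 ≤ A p := fun p => Finset.sum_nonneg fun l _ =>
    mul_nonneg (mjDelta_nonneg p l) (Finset.prod_nonneg fun j _ => hf j _)
  have hF0 : ∀ j, 0 ≤ ∑ l ∈ L j, f j l := fun j => Finset.sum_nonneg fun l _ => hf j l
  have hB0 : 0 < B := by positivity
  have hE0 : 0 ≤ E := Finset.sum_nonneg fun p _ => Real.rpow_nonneg (hA0 p) _
  rcases hE0.eq_or_lt with hE0 | hEpos
  · rw [← hE0]
    exact mul_nonneg (Real.rpow_nonneg (by positivity) _)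
      (Finset.prod_nonneg fun j _ => Real.rpow_nonneg (hF0 j) _)
  set m : ℕ := P.card + 1 with hm
  have hm0 : (0 : ℝ) < m := by positivity
  let w : (Fin d → F) → ℝ := fun p => (m : ℝ) ^ d / (2 * E) * A p ^ θ
  obtain ⟨S, hS1, hS2⟩ := exists_line_weights m L hL P w
    (fun p => mul_nonneg (by positivity) (Real.rpow_nonneg (hA0 p) _)) (by
      rw [← Finset.mul_sum, ← hE, div_mul_eq_mul_div, mul_div_mul_right _ _ hEpos.ne']
      exact half_lt_self (by positivity))
  let H : Fin d → (Fin d → F) → ℝ := fun j p =>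
    ∑ l ∈ L j, if p ∈ l then f j l * S p l else 0
  have hH0 : ∀ j p, 0 ≤ H j p := fun j p => Finset.sum_nonneg fun l _ => by
    split_ifs
    · exact mul_nonneg (hf j l) (Nat.cast_nonneg _)
    · exact le_rfl
  have hHsum : ∀ j, ∑ p ∈ P, H j p ≤ B * m * ∑ l ∈ L j, f j l := by
    intro j
    simp only [H]
    rw [Finset.sum_comm, Finset.mul_sum]
    refine Finset.sum_le_sum fun l _ => ?_
    rw [← Finset.sum_filter, ← Finset.mul_sum, mul_comm]
    refine mul_le_mul_of_nonneg_right ?_ (hf j l)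
    have h1 : (∑ p ∈ P with p ∈ l, (S p l : ℝ)) ≤ d * m + 2 * P.card := by
      exact_mod_cast hS1 l
    have h2 : (m : ℝ) = P.card + 1 := by simp [hm]
    rw [hB, add_mul]
    linarith
  have hAH : ∀ p ∈ P, A p * w p ≤ ∏ j, H j p := by
    intro p hp
    simp only [H]
    rw [Finset.prod_univ_sum, hA, Finset.sum_mul]
    refine Finset.sum_le_sum fun l hl => ?_
    by_cases hδ : mjDelta p l = 0
    · rw [hδ, zero_mul, zero_mul]
      refine Finset.prod_nonneg fun j _ => ?_
      split_ifs
      · exact mul_nonneg (hf j _) (Nat.cast_nonneg _)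
      · exact le_rfl
    · obtain ⟨h1, hmem, _⟩ := mjDelta_eq_one_of_ne_zero hδ
      simp only [hmem, if_true, Finset.prod_mul_distrib, h1, one_mul]
      exact mul_le_mul_of_nonneg_left (hS2 p hp l hl hδ) (Finset.prod_nonneg fun j _ => hf j _)
  have hpoint : ∀ p ∈ P, m * A p ^ θ ≤ (2 * E) ^ ((d : ℝ)⁻¹) * ∏ j, H j p ^ ((d : ℝ)⁻¹) := by
    intro p hp
    have hx0 : 0 ≤ (m : ℝ) * A p ^ θ := mul_nonneg hm0.le (Real.rpow_nonneg (hA0 p) _)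
    have h1 : (m * A p ^ θ) ^ d ≤ 2 * E * ∏ j, H j p := by
      refine le_trans (le_of_eq ?_) (mul_le_mul_of_nonneg_left (hAH p hp) (by positivity))
      rw [mul_pow, rpow_inv_sub_one_pow hd (hA0 p)]
      simp only [w]
      generalize A p ^ θ = x
      field_simp
    calc m * A p ^ θ = ((m * A p ^ θ) ^ d) ^ ((d : ℝ)⁻¹) :=
          (Real.pow_rpow_inv_natCast hx0 hd0.ne').symm
      _ ≤ (2 * E * ∏ j, H j p) ^ ((d : ℝ)⁻¹) :=
          Real.rpow_le_rpow (pow_nonneg hx0 _) h1 (by positivity)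
      _ = _ := by
          rw [Real.mul_rpow (by positivity) (Finset.prod_nonneg fun j _ => hH0 j p),
            Real.finsetProd_rpow _ _ fun j _ => hH0 j p]
  have hG0 : ∀ j, 0 ≤ B * m * ∑ l ∈ L j, f j l := fun j => mul_nonneg (by positivity) (hF0 j)
  have hmE : m * E ≤ (2 * E) ^ ((d : ℝ)⁻¹) *
      (∏ j, (B * m * ∑ l ∈ L j, f j l)) ^ ((d : ℝ)⁻¹) := by
    rw [hE, Finset.mul_sum, ← hE]
    refine (Finset.sum_le_sum hpoint).trans ?_
    rw [← Finset.mul_sum, ← Real.finsetProd_rpow _ _ fun j _ => hG0 j]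
    exact mul_le_mul_of_nonneg_left (sum_prod_rpow_le hd0 P H hH0 _ hHsum)
      (Real.rpow_nonneg (by positivity) _)
  have hmEd : (m * E) ^ d ≤ 2 * E * ((B * m) ^ d * ∏ j, ∑ l ∈ L j, f j l) := by
    refine (pow_le_pow_left₀ (by positivity) hmE d).trans (le_of_eq ?_)
    rw [mul_pow, Real.rpow_inv_natCast_pow (by positivity) hd0.ne',
      Real.rpow_inv_natCast_pow (Finset.prod_nonneg fun j _ => hG0 j) hd0.ne',
      Finset.prod_mul_distrib]
    simp
  have hEd : E ^ (d - 1) ≤ 2 * B ^ d * ∏ j, ∑ l ∈ L j, f j l := by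
    have hsplit : E ^ d = E ^ (d - 1) * E := by
      rw [← pow_succ, Nat.sub_add_cancel (by omega)]
    rw [mul_pow, mul_pow, hsplit] at hmEd
    refine le_of_mul_le_mul_left ?_ (show 0 < (m : ℝ) ^ d * E by positivity)
    linarith
  have hcast : θ = ((d - 1 : ℕ) : ℝ)⁻¹ := by
    rw [hθ, Nat.cast_sub (by omega), Nat.cast_one]
  calc E = (E ^ (d - 1)) ^ θ := by
        rw [hcast, Real.pow_rpow_inv_natCast hEpos.le (by omega)]
    _ ≤ (2 * B ^ d * ∏ j, ∑ l ∈ L j, f j l) ^ θ :=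
        Real.rpow_le_rpow (by positivity) hEd (inv_nonneg.mpr hd1.le)
    _ = _ := by
        rw [Real.mul_rpow (by positivity) (Finset.prod_nonneg fun j _ => hF0 j),
          Real.finsetProd_rpow _ _ fun j _ => hF0 j]

end Multijoint

/-- **Multijoint inequality for lines (Zhang's theorem).**
Let `d ≥ 2` and `F` a field, and let `L 0, …, L (d-1)` be finite sets of affine lines in `F^d`.
There is a constant `C = C(d)` such that for all `f j : L j → ℝ≥0`,
`∑ p, (∑ l₁ ∈ L 0, …, ∑ l_d ∈ L (d-1), δ(p, l) * ∏ j, f j (l j)) ^ (1/(d-1))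
  ≤ C * ∏ j, (∑ l ∈ L j, f j l) ^ (1/(d-1))`. -/
theorem multijoint_inequality_lines (d : ℕ) (hd : 2 ≤ d) :
    ∃ C : ℝ, 0 < C ∧
      ∀ (F : Type) [Field F]
        (L : Fin d → Finset (AffineSubspace F (Fin d → F))),
        (∀ j, ∀ l ∈ L j,
          (l : Set (Fin d → F)).Nonempty ∧ Module.finrank F l.direction = 1) →
        ∀ f : Fin d → AffineSubspace F (Fin d → F) → ℝ,
          (∀ j l, 0 ≤ f j l) →
          (∑ᶠ p : Fin d → F,
              (∑ l ∈ Fintype.piFinset L, mjDelta p l * ∏ j, f j (l j))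
                ^ (((d : ℝ) - 1)⁻¹))
            ≤ C * ∏ j, (∑ l ∈ L j, f j l) ^ (((d : ℝ) - 1)⁻¹) := by
  refine ⟨(2 * ((d : ℝ) + 2) ^ d) ^ (((d : ℝ) - 1)⁻¹), by positivity, ?_⟩
  classical
  intro F _ L hL f hf
  rw [finsum_def]
  split_ifs with hfin
  · exact Multijoint.sum_multijoint_le hd L (fun j l hl => (hL j l hl).2) f hf _
  · exact mul_nonneg (by positivity) (Finset.prod_nonneg fun j _ =>
      Real.rpow_nonneg (Finset.sum_nonneg fun l _ => hf j l) _)
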